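/- There exist universal constants c_1, c_2 > 0 such that the following holds. Let X_1,…,X_n be i.i.d. real-valued random variables with cumulative distribution function F and empirical cumulative distribution function F_n. For any x_0 ∈ ℝ and any t ≥ 0, P( sup_{x ≤ x_0} |F_n(x) − F(x)| > t·√(F(x_0)/n) ) ≤ c_1 · exp(−c_2 · min(t², t·√(n·F(x_0)))). -/

import Mathlib

open MeasureTheory ProbabilityTheory Filter ENNReal

/-- The cumulative distribution function of a measure `ν` on `ℝ`. -/
noncomputable def cdfOf (ν : Measure ℝ) (x : ℝ) : ℝ := (ν (Set.Iic x)).toReal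

/-- The empirical cumulative distribution function of samples `ω : Fin n → ℝ`. -/
noncomputable def ecdf (n : ℕ) (ω : Fin n → ℝ) (x : ℝ) : ℝ :=
  (∑ i, if ω i ≤ x then (1 : ℝ) else 0) / n

/-- The Rademacher sign `1` or `-1` attached to a Boolean. -/
def boolSign (b : Bool) : ℝ := if b then 1 else -1

lemma sum_boolSign_flip {ι : Type*} [DecidableEq ι] {a : ι} {s : Finset ι} (ha : a ∉ s)
    (ε : ι → Bool) :
    ∑ i ∈ s, boolSign (Function.update ε a (!ε a) i) = ∑ i ∈ s, boolSign (ε i) := by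
  refine Finset.sum_congr rfl fun i hi => ?_
  rw [Function.update_of_ne (ne_of_mem_of_not_mem hi ha)]

section Rademacher

variable {ι : Type*} [Fintype ι] [DecidableEq ι]

lemma sum_flip_eq (a : ι) (g : (ι → Bool) → ℝ) :
    ∑ ε, g (Function.update ε a (!ε a)) = ∑ ε, g ε := by
  have h : Function.Involutive fun ε : ι → Bool => Function.update ε a (!ε a) := by
    intro ε
    simp
  exact Equiv.sum_comp h.toPerm g

lemma sum_mul_cosh_insert {a : ι} {s : Finset ι} (ha : a ∉ s) (l : ℝ) {f : (ι → Bool) → ℝ}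
    (hf : ∀ ε, f (Function.update ε a (!ε a)) = f ε) :
    ∑ ε, f ε * Real.cosh (l * ∑ i ∈ insert a s, boolSign (ε i)) =
      Real.cosh l * ∑ ε, f ε * Real.cosh (l * ∑ i ∈ s, boolSign (ε i)) := by
  have h := sum_flip_eq a fun ε => f ε * Real.cosh (l * ∑ i ∈ insert a s, boolSign (ε i))
  have key : ∑ ε, (f ε * Real.cosh (l * ∑ i ∈ insert a s, boolSign (ε i)) +
      f (Function.update ε a (!ε a)) *
        Real.cosh (l * ∑ i ∈ insert a s, boolSign (Function.update ε a (!ε a) i))) =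
      2 * (Real.cosh l * ∑ ε, f ε * Real.cosh (l * ∑ i ∈ s, boolSign (ε i))) := by
    rw [Finset.mul_sum, Finset.mul_sum]
    refine Finset.sum_congr rfl fun ε _ => ?_
    simp only [Finset.sum_insert ha, sum_boolSign_flip ha, hf, Function.update_self]
    cases ε a <;> simp [boolSign, mul_add, Real.cosh_add] <;> ring
  rw [Finset.sum_add_distrib] at key
  linarith

lemma sum_cosh_eq (l : ℝ) (s : Finset ι) :
    ∑ ε : ι → Bool, Real.cosh (l * ∑ i ∈ s, boolSign (ε i)) =
      2 ^ Fintype.card ι * Real.cosh l ^ s.card := by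
  induction s using Finset.induction_on with
  | empty => simp
  | insert a s ha ih =>
    have h := sum_mul_cosh_insert ha l (f := fun _ => 1) fun _ => rfl
    simp only [one_mul] at h
    rw [h, ih, Finset.card_insert_of_notMem ha]
    ring

lemma sum_cosh_sq_le (l : ℝ) (s : Finset ι) :
    ∑ ε : ι → Bool, Real.cosh (l * ∑ i ∈ s, boolSign (ε i)) ^ 2 ≤
      2 ^ Fintype.card ι * Real.cosh (2 * l) ^ s.card := by
  rw [← sum_cosh_eq]
  refine Finset.sum_le_sum fun ε _ => ?_
  rw [mul_assoc, Real.cosh_two_mul]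
  linarith [sq_nonneg (Real.sinh (l * ∑ i ∈ s, boolSign (ε i)))]

/-- Doob's `L²` maximal inequality for the submartingale `cosh (l * S)`, where `S` runs over the
partial sums of a Rademacher sequence ordered by the values `w`. -/
lemma exists_maximal_cosh (w : ι → ℝ) (l : ℝ) (s : Finset ι) :
    ∃ M : (ι → Bool) → ℝ,
      (∀ a ∉ s, ∀ ε, M (Function.update ε a (!ε a)) = M ε) ∧ (∀ ε, 0 ≤ M ε) ∧
      (∀ ε x, Real.cosh (l * ∑ i ∈ s with w i ≤ x, boolSign (ε i)) ≤ M ε) ∧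
      ∑ ε, 2 * M ε ^ 2 ≤ ∑ ε, 4 * (M ε * Real.cosh (l * ∑ i ∈ s, boolSign (ε i))) := by
  induction s using Finset.induction_on_max_value w with
  | empty =>
    refine ⟨fun _ => 1, by simp, by simp, by simp, ?_⟩
    refine Finset.sum_le_sum fun ε _ => by norm_num
  | insert a s ha hmax ih =>
    obtain ⟨M, hflip, h0, hM, hsum⟩ := ih
    refine ⟨fun ε => max (M ε) (Real.cosh (l * ∑ i ∈ insert a s, boolSign (ε i))), ?_,
      fun ε => le_max_of_le_left (h0 ε), ?_, ?_⟩
    · intro b hb ε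
      beta_reduce
      rw [hflip b (fun h => hb (Finset.mem_insert_of_mem h)), sum_boolSign_flip hb]
    · intro ε x
      by_cases hx : w a ≤ x
      · refine le_max_of_le_right (le_of_eq ?_)
        rw [Finset.filter_true_of_mem]
        intro i hi
        rcases Finset.mem_insert.1 hi with rfl | hi
        · exact hx
        · exact (hmax i hi).trans hx
      · refine le_max_of_le_left ?_
        rw [Finset.filter_insert, if_neg hx]
        exact hM ε x
    · have hstep : ∑ ε, 4 * (M ε * Real.cosh (l * ∑ i ∈ s, boolSign (ε i))) ≤
          ∑ ε, 4 * (M ε * Real.cosh (l * ∑ i ∈ insert a s, boolSign (ε i))) := by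
        rw [← Finset.mul_sum, ← Finset.mul_sum, sum_mul_cosh_insert ha l (hflip a ha)]
        gcongr
        refine le_mul_of_one_le_left ?_ (Real.one_le_cosh l)
        exact Finset.sum_nonneg fun ε _ => mul_nonneg (h0 ε) (Real.cosh_pos _).le
      have hpath : ∑ ε, (2 * max (M ε) (Real.cosh (l * ∑ i ∈ insert a s, boolSign (ε i))) ^ 2 -
            4 * (max (M ε) (Real.cosh (l * ∑ i ∈ insert a s, boolSign (ε i))) *
              Real.cosh (l * ∑ i ∈ insert a s, boolSign (ε i)))) ≤
          ∑ ε, (2 * M ε ^ 2 - 4 * (M ε * Real.cosh (l * ∑ i ∈ insert a s, boolSign (ε i)))) := by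
        refine Finset.sum_le_sum fun ε _ => ?_
        rcases max_cases (M ε) (Real.cosh (l * ∑ i ∈ insert a s, boolSign (ε i))) with h | h
        · rw [h.1]
        · rw [h.1]
          nlinarith [sq_nonneg (M ε - Real.cosh (l * ∑ i ∈ insert a s, boolSign (ε i)))]
      rw [Finset.sum_sub_distrib, Finset.sum_sub_distrib] at hpath
      linarith

/-- An exponential moment bound for a Rademacher sum maximised over initial segments: the value
`R ε` is any quantity dominated by one of the partial sums. -/
lemma sum_exp_maximal_le (w : ι → ℝ) (x₀ l : ℝ) (hl : 0 ≤ l) (R : (ι → Bool) → ℝ)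
    (hR : ∀ ε, ∃ x ≤ x₀, R ε ≤ |∑ i with w i ≤ x, boolSign (ε i)|) :
    ∑ ε, Real.exp (2 * l * R ε) ≤
      2 ^ Fintype.card ι * (16 * Real.cosh (2 * l) ^ (Finset.univ.filter (w · ≤ x₀)).card) := by
  obtain ⟨M, -, h0, hM, hsum⟩ := exists_maximal_cosh w l (Finset.univ.filter (w · ≤ x₀))
  set s := Finset.univ.filter (w · ≤ x₀)
  have hexp : ∀ ε, Real.exp (2 * l * R ε) ≤ 4 * M ε ^ 2 := by
    intro ε
    obtain ⟨x, hx, hRx⟩ := hR ε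
    have hfil : s.filter (w · ≤ x) = Finset.univ.filter (w · ≤ x) := by
      ext i
      simp only [s, Finset.mem_filter, Finset.mem_univ, true_and, and_iff_right_iff_imp]
      exact fun h => h.trans hx
    have h1 : Real.exp (l * R ε) ≤ 2 * M ε := by
      calc Real.exp (l * R ε) ≤ Real.exp |l * ∑ i with w i ≤ x, boolSign (ε i)| := by
            rw [abs_mul, abs_of_nonneg hl]
            gcongr
        _ ≤ 2 * Real.cosh (l * ∑ i with w i ≤ x, boolSign (ε i)) := by
            rw [Real.cosh_eq]
            linarith [Real.exp_abs_le (l * ∑ i with w i ≤ x, boolSign (ε i))]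
        _ ≤ 2 * M ε := by
            have := hM ε x
            rw [hfil] at this
            linarith
    calc Real.exp (2 * l * R ε) = Real.exp (l * R ε) ^ 2 := by
          rw [← Real.exp_nat_mul]; push_cast; ring_nf
      _ ≤ (2 * M ε) ^ 2 := by gcongr
      _ = 4 * M ε ^ 2 := by ring
  have hdoob : ∑ ε, M ε ^ 2 ≤
      ∑ ε : ι → Bool, 4 * Real.cosh (l * ∑ i ∈ s, boolSign (ε i)) ^ 2 := by
    have : ∑ ε, (M ε ^ 2 + 4 * (M ε * Real.cosh (l * ∑ i ∈ s, boolSign (ε i)))) ≤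
        ∑ ε, (2 * M ε ^ 2 + 4 * Real.cosh (l * ∑ i ∈ s, boolSign (ε i)) ^ 2) := by
      refine Finset.sum_le_sum fun ε _ => ?_
      nlinarith [sq_nonneg (M ε - 2 * Real.cosh (l * ∑ i ∈ s, boolSign (ε i)))]
    rw [Finset.sum_add_distrib, Finset.sum_add_distrib] at this
    linarith
  rw [← Finset.mul_sum] at hdoob
  calc ∑ ε, Real.exp (2 * l * R ε) ≤ ∑ ε, 4 * M ε ^ 2 := Finset.sum_le_sum fun ε _ => hexp ε
    _ = 4 * ∑ ε, M ε ^ 2 := by rw [Finset.mul_sum]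
    _ ≤ _ := by linarith [sum_cosh_sq_le l s]

end Rademacher

/-- The indicator of the half-line `(-∞, x]`. -/
noncomputable def iicInd (x y : ℝ) : ℝ := if y ≤ x then 1 else 0

@[fun_prop]
lemma measurable_iicInd (x : ℝ) : Measurable (iicInd x) :=
  Measurable.ite measurableSet_Iic measurable_const measurable_const

lemma iicInd_mem_Icc (x y : ℝ) : iicInd x y ∈ Set.Icc (0 : ℝ) 1 := by
  unfold iicInd
  split_ifs <;> simp

lemma integral_iicInd (ν : Measure ℝ) (x : ℝ) : ∫ y, iicInd x y ∂ν = cdfOf ν x := by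
  have h : iicInd x = (Set.Iic x).indicator 1 := by
    ext y
    simp [iicInd, Set.indicator_apply]
  rw [h, integral_indicator_one measurableSet_Iic]
  rfl

lemma integrable_iicInd (ν : Measure ℝ) [IsFiniteMeasure ν] (x : ℝ) :
    Integrable (iicInd x) ν :=
  Integrable.of_mem_Icc 0 1 (measurable_iicInd x).aemeasurable (ae_of_all _ (iicInd_mem_Icc x))

lemma integrable_exp_mul_of_le {α : Type*} [MeasurableSpace α] {μ : Measure α} [IsFiniteMeasure μ]
    {u : α → ℝ} (hu : Measurable u) {l C : ℝ} (hl : 0 ≤ l) (hC : ∀ a, u a ≤ C) :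
    Integrable (fun a => Real.exp (l * u a)) μ := by
  refine Integrable.of_mem_Icc 0 (Real.exp (l * C)) (by fun_prop) (ae_of_all _ fun a => ?_)
  exact ⟨(Real.exp_pos _).le, Real.exp_le_exp.2 (mul_le_mul_of_nonneg_left (hC a) hl)⟩

lemma norm_sum_le_card {n : ℕ} {T : Finset ℝ} {f : T → Fin n → ℝ} (hf : ∀ x i, |f x i| ≤ 1) :
    ‖fun x => ∑ i, f x i‖ ≤ n := by
  refine (pi_norm_le_iff_of_nonneg (Nat.cast_nonneg n)).2 fun x => ?_
  calc |∑ i, f x i| ≤ ∑ i, |f x i| := Finset.abs_sum_le_sum_abs _ _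
    _ ≤ ∑ _i : Fin n, 1 := Finset.sum_le_sum fun i _ => hf x i
    _ = n := by simp

lemma measurable_norm_pi {α : Type*} [MeasurableSpace α] {T : Finset ℝ} {f : α → T → ℝ}
    (hf : ∀ x, Measurable fun a => f a x) : Measurable fun a => ‖f a‖ :=
  (measurable_pi_lambda f hf).norm

lemma abs_iicInd_sub_le (x a b : ℝ) : |iicInd x a - iicInd x b| ≤ 1 := by
  have ha := iicInd_mem_Icc x a
  have hb := iicInd_mem_Icc x b
  rw [abs_le]
  constructor <;> linarith [ha.1, ha.2, hb.1, hb.2]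

section Symmetrization

variable {n : ℕ} (ν : Measure ℝ) [IsProbabilityMeasure ν] (T : Finset ℝ)

lemma norm_centred_le_integral (ω : Fin n → ℝ) :
    ‖fun x : T => ∑ i, (iicInd x (ω i) - cdfOf ν x)‖ ≤
      ∫ ω', ‖fun x : T => ∑ i, (iicInd x (ω i) - iicInd x (ω' i))‖
        ∂(Measure.pi fun _ : Fin n => ν) := by
  have hint : Integrable (fun ω' : Fin n → ℝ =>
      ‖fun x : T => ∑ i, (iicInd x (ω i) - iicInd x (ω' i))‖) (Measure.pi fun _ => ν) := by
    refine Integrable.of_mem_Icc 0 n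
      (measurable_norm_pi fun x => by fun_prop).aemeasurable (ae_of_all _ fun ω' => ?_)
    exact ⟨norm_nonneg _, norm_sum_le_card fun x i => abs_iicInd_sub_le _ _ _⟩
  refine (pi_norm_le_iff_of_nonneg (integral_nonneg fun _ => norm_nonneg _)).2 fun x => ?_
  have hmean (i : Fin n) : ∫ ω', iicInd x (ω' i) ∂(Measure.pi fun _ : Fin n => ν) =
      cdfOf ν x := by
    have hmp := measurePreserving_eval (fun _ : Fin n => ν) i
    rw [← integral_iicInd ν, ← integral_map (f := iicInd x) hmp.measurable.aemeasurable
      (measurable_iicInd x).aestronglyMeasurable, hmp.map_eq]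
  have hi (i : Fin n) : Integrable (fun ω' : Fin n → ℝ => iicInd x (ω' i))
      (Measure.pi fun _ => ν) :=
    (measurePreserving_eval (fun _ : Fin n => ν) i).integrable_comp_of_integrable
      (integrable_iicInd ν x)
  have h : ∑ i, (iicInd x (ω i) - cdfOf ν x) =
      ∫ ω', ∑ i, (iicInd x (ω i) - iicInd x (ω' i)) ∂(Measure.pi fun _ : Fin n => ν) := by
    rw [integral_finsetSum (f := fun i (ω' : Fin n → ℝ) => iicInd x (ω i) - iicInd x (ω' i)) _
      fun i _ => (integrable_const _).sub (hi i)]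
    refine Finset.sum_congr rfl fun i _ => ?_
    rw [integral_sub (integrable_const _) (hi i), hmean, integral_const]
    simp
  beta_reduce
  rw [h]
  refine (norm_integral_le_integral_norm _).trans ?_
  refine integral_mono_of_nonneg (ae_of_all _ fun _ => norm_nonneg _) hint (ae_of_all _ fun ω' => ?_)
  exact norm_le_pi_norm (fun x : T => ∑ i, (iicInd x (ω i) - iicInd x (ω' i))) x

lemma integral_exp_centred_le {l : ℝ} (hl : 0 ≤ l) :
    ∫ ω, Real.exp (l * ‖fun x : T => ∑ i, (iicInd x (ω i) - cdfOf ν x)‖)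
        ∂(Measure.pi fun _ : Fin n => ν) ≤
      ∫ z, Real.exp (l * ‖fun x : T => ∑ i, (iicInd x (z i).1 - iicInd x (z i).2)‖)
        ∂(Measure.pi fun _ : Fin n => ν.prod ν) := by
  set μ := Measure.pi fun _ : Fin n => ν
  let H : (Fin n → ℝ) × (Fin n → ℝ) → ℝ :=
    fun q => ‖fun x : T => ∑ i, (iicInd x (q.1 i) - iicInd x (q.2 i))‖
  have hHm : Measurable H := measurable_norm_pi fun x => by fun_prop
  have hHn (q) : H q ≤ n := norm_sum_le_card fun x i => abs_iicInd_sub_le _ _ _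
  have hHi : Integrable (fun q => Real.exp (l * H q)) (μ.prod μ) :=
    integrable_exp_mul_of_le hHm hl hHn
  have hprod : ∫ z, Real.exp (l * ‖fun x : T => ∑ i, (iicInd x (z i).1 - iicInd x (z i).2)‖)
        ∂(Measure.pi fun _ : Fin n => ν.prod ν) = ∫ q, Real.exp (l * H q) ∂(μ.prod μ) :=
    (measurePreserving_arrowProdEquivProdArrow ℝ ℝ (Fin n) (fun _ => ν)
      (fun _ => ν)).integral_comp' fun q => Real.exp (l * H q)
  rw [hprod, integral_prod _ hHi]
  refine integral_mono_of_nonneg (ae_of_all _ fun _ => (Real.exp_pos _).le)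
    hHi.integral_prod_left (ae_of_all _ fun ω => ?_)
  have hm : Measurable fun ω' => H (ω, ω') := hHm.comp measurable_prodMk_left
  have h1 : Integrable (fun ω' => l * H (ω, ω')) μ :=
    (Integrable.of_mem_Icc 0 n hm.aemeasurable
      (ae_of_all _ fun ω' => ⟨norm_nonneg _, hHn _⟩)).const_mul l
  calc Real.exp (l * ‖fun x : T => ∑ i, (iicInd x (ω i) - cdfOf ν x)‖)
      ≤ Real.exp (∫ ω', l * H (ω, ω') ∂μ) := by
        rw [integral_const_mul]
        gcongr
        exact norm_centred_le_integral ν T ω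
    _ ≤ ∫ ω', Real.exp (l * H (ω, ω')) ∂μ :=
        convexOn_exp.map_integral_le Real.continuous_exp.continuousOn isClosed_univ (by simp) h1
          (integrable_exp_mul_of_le hm hl fun ω' => hHn _)

lemma integral_exp_signed_eq (l : ℝ) (ε : Fin n → Bool) :
    ∫ z, Real.exp (l * ‖fun x : T => ∑ i, boolSign (ε i) * (iicInd x (z i).1 - iicInd x (z i).2)‖)
        ∂(Measure.pi fun _ : Fin n => ν.prod ν) =
      ∫ z, Real.exp (l * ‖fun x : T => ∑ i, (iicInd x (z i).1 - iicInd x (z i).2)‖)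
        ∂(Measure.pi fun _ : Fin n => ν.prod ν) := by
  have hf (i : Fin n) : MeasurePreserving (fun q : ℝ × ℝ => if ε i then q else q.swap)
      (ν.prod ν) (ν.prod ν) := by
    cases ε i
    · simpa using Measure.measurePreserving_swap
    · exact MeasurePreserving.id (ν.prod ν)
  have hmp := measurePreserving_pi (fun _ : Fin n => ν.prod ν) (fun _ => ν.prod ν) hf
  have hG : Measurable fun z : Fin n → ℝ × ℝ =>
      Real.exp (l * ‖fun x : T => ∑ i, (iicInd x (z i).1 - iicInd x (z i).2)‖) :=
    ((measurable_norm_pi fun x => by fun_prop).const_mul l).exp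
  conv_rhs => rw [← hmp.map_eq, integral_map hmp.measurable.aemeasurable hG.aestronglyMeasurable]
  congr! 7 with z x i
  cases h : ε i <;> simp [boolSign, h]

lemma sum_exp_signed_le {x₀ : ℝ} (hT : ∀ x ∈ T, x ≤ x₀) {l : ℝ} (hl : 0 ≤ l) (ω : Fin n → ℝ) :
    ∑ ε : Fin n → Bool, Real.exp (2 * l * ‖fun x : T => ∑ i, boolSign (ε i) * iicInd x (ω i)‖) ≤
      2 ^ n * (16 * ∏ i, if ω i ≤ x₀ then Real.cosh (2 * l) else 1) := by
  have h := sum_exp_maximal_le ω x₀ l hl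
    (fun ε => ‖fun x : T => ∑ i, boolSign (ε i) * iicInd x (ω i)‖) ?_
  · rwa [Fintype.card_fin, ← Finset.prod_const, Finset.prod_filter] at h
  · intro ε
    rcases isEmpty_or_nonempty T with hE | hE
    · refine ⟨x₀, le_rfl, ?_⟩
      rw [pi_norm_le_iff_of_nonneg (abs_nonneg _)]
      exact fun x => hE.elim x
    · obtain ⟨x, hx⟩ := Finite.exists_max fun x : T => |∑ i, boolSign (ε i) * iicInd x (ω i)|
      refine ⟨x, hT x x.2, ?_⟩
      rw [pi_norm_le_iff_of_nonneg (abs_nonneg _)]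
      intro y
      refine (hx y).trans_eq ?_
      simp [iicInd, Finset.sum_filter]

lemma sum_exp_signed_sub_le {x₀ : ℝ} (hT : ∀ x ∈ T, x ≤ x₀) {l : ℝ} (hl : 0 ≤ l)
    (z : Fin n → ℝ × ℝ) :
    ∑ ε : Fin n → Bool, Real.exp (l *
        ‖fun x : T => ∑ i, boolSign (ε i) * (iicInd x (z i).1 - iicInd x (z i).2)‖) ≤
      2 ^ n * (8 * (∏ i, if (z i).1 ≤ x₀ then Real.cosh (2 * l) else 1) +
        8 * ∏ i, if (z i).2 ≤ x₀ then Real.cosh (2 * l) else 1) := by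
  have hε (ε : Fin n → Bool) : Real.exp (l *
        ‖fun x : T => ∑ i, boolSign (ε i) * (iicInd x (z i).1 - iicInd x (z i).2)‖) ≤
      (Real.exp (2 * l * ‖fun x : T => ∑ i, boolSign (ε i) * iicInd x (z i).1‖) +
        Real.exp (2 * l * ‖fun x : T => ∑ i, boolSign (ε i) * iicInd x (z i).2‖)) / 2 := by
    set u := ‖fun x : T => ∑ i, boolSign (ε i) * iicInd x (z i).1‖
    set v := ‖fun x : T => ∑ i, boolSign (ε i) * iicInd x (z i).2‖
    have htri : ‖fun x : T => ∑ i, boolSign (ε i) * (iicInd x (z i).1 - iicInd x (z i).2)‖ ≤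
        u + v := by
      refine le_trans (le_of_eq ?_) (norm_sub_le _ _)
      congr 1
      ext x
      simp [mul_sub]
    calc _ ≤ Real.exp (l * (u + v)) := by gcongr
      _ = Real.exp (l * u) * Real.exp (l * v) := by rw [mul_add, Real.exp_add]
      _ ≤ (Real.exp (l * u) ^ 2 + Real.exp (l * v) ^ 2) / 2 := by
        nlinarith [sq_nonneg (Real.exp (l * u) - Real.exp (l * v))]
      _ = _ := by
        rw [← Real.exp_nat_mul, ← Real.exp_nat_mul]
        push_cast
        simp only [mul_assoc]
  refine (Finset.sum_le_sum fun ε _ => hε ε).trans ?_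
  rw [← Finset.sum_div, Finset.sum_add_distrib]
  linarith [sum_exp_signed_le T hT hl fun i => (z i).1, sum_exp_signed_le T hT hl fun i => (z i).2]

lemma integral_prod_ite {α : Type*} [MeasurableSpace α] (m : Measure α) [IsProbabilityMeasure m]
    (f : α → ℝ) (x₀ c : ℝ) (hf : MeasurePreserving f m ν) :
    ∫ z, (∏ i, if f (z i) ≤ x₀ then c else 1) ∂(Measure.pi fun _ : Fin n => m) =
      (1 + cdfOf ν x₀ * (c - 1)) ^ n := by
  rw [integral_fintype_prod_eq_prod (fun _ y => if f y ≤ x₀ then c else 1)]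
  have h (y : α) : (if f y ≤ x₀ then c else 1) = 1 + iicInd x₀ (f y) * (c - 1) := by
    unfold iicInd
    split_ifs <;> simp
  have hi : Integrable (fun y => iicInd x₀ (f y)) m :=
    hf.integrable_comp_of_integrable (integrable_iicInd ν x₀)
  have hmean : ∫ y, iicInd x₀ (f y) ∂m = cdfOf ν x₀ := by
    rw [← integral_iicInd ν, ← integral_map (f := iicInd x₀) hf.measurable.aemeasurable
      (measurable_iicInd x₀).aestronglyMeasurable, hf.map_eq]
  simp only [h]
  rw [integral_add (integrable_const _) (hi.mul_const _), integral_mul_const, hmean]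
  simp

lemma integrable_prod_ite {α : Type*} [MeasurableSpace α] (m : Measure α) [IsProbabilityMeasure m]
    (f : α → ℝ) (x₀ c : ℝ) (hf : Measurable f) :
    Integrable (fun z => ∏ i, if f (z i) ≤ x₀ then c else 1)
      (Measure.pi fun _ : Fin n => m) := by
  refine Integrable.fintype_prod (f := fun _ y => if f y ≤ x₀ then c else 1) fun i => ?_
  refine Integrable.of_bound (C := max |c| 1) ?_ (ae_of_all _ fun y => ?_)
  · exact (Measurable.ite (hf measurableSet_Iic) measurable_const
      measurable_const).aestronglyMeasurable
  · split_ifs <;> simp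

lemma integral_exp_norm_le {x₀ : ℝ} (hT : ∀ x ∈ T, x ≤ x₀) {l : ℝ} (hl : 0 ≤ l) :
    ∫ ω, Real.exp (l * ‖fun x : T => ∑ i, (iicInd x (ω i) - cdfOf ν x)‖)
        ∂(Measure.pi fun _ : Fin n => ν) ≤
      16 * Real.exp (n * cdfOf ν x₀ * (Real.cosh (2 * l) - 1)) := by
  refine (integral_exp_centred_le ν T hl).trans ?_
  set Q := Measure.pi fun _ : Fin n => ν.prod ν
  set C := Real.cosh (2 * l)
  set p := cdfOf ν x₀
  have hp : 0 ≤ p := ENNReal.toReal_nonneg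
  have hC : 0 ≤ C - 1 := sub_nonneg.2 (Real.one_le_cosh _)
  have hi1 : Integrable (fun z : Fin n → ℝ × ℝ => ∏ i, if (z i).1 ≤ x₀ then C else 1) Q :=
    integrable_prod_ite _ Prod.fst x₀ C measurable_fst
  have hi2 : Integrable (fun z : Fin n → ℝ × ℝ => ∏ i, if (z i).2 ≤ x₀ then C else 1) Q :=
    integrable_prod_ite _ Prod.snd x₀ C measurable_snd
  have hiε (ε : Fin n → Bool) : Integrable (fun z : Fin n → ℝ × ℝ => Real.exp (l *
      ‖fun x : T => ∑ i, boolSign (ε i) * (iicInd x (z i).1 - iicInd x (z i).2)‖)) Q := by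
    refine integrable_exp_mul_of_le (C := n) (measurable_norm_pi fun x => by fun_prop) hl
      fun z => norm_sum_le_card fun x i => ?_
    have := abs_iicInd_sub_le x (z i).1 (z i).2
    cases ε i <;> simpa [boolSign, abs_sub_comm] using this
  have hsum : 2 ^ n * ∫ z, Real.exp (l *
        ‖fun x : T => ∑ i, (iicInd x (z i).1 - iicInd x (z i).2)‖) ∂Q ≤
      2 ^ n * (16 * (1 + p * (C - 1)) ^ n) := by
    calc _ = ∑ ε : Fin n → Bool, ∫ z, Real.exp (l *
          ‖fun x : T => ∑ i, boolSign (ε i) * (iicInd x (z i).1 - iicInd x (z i).2)‖) ∂Q := by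
          simp only [Q, integral_exp_signed_eq]
          simp
      _ = ∫ z, ∑ ε : Fin n → Bool, Real.exp (l *
          ‖fun x : T => ∑ i, boolSign (ε i) * (iicInd x (z i).1 - iicInd x (z i).2)‖) ∂Q :=
          (integral_finsetSum _ fun ε _ => hiε ε).symm
      _ ≤ ∫ z, 2 ^ n * (8 * (∏ i, if (z i).1 ≤ x₀ then C else 1) +
          8 * ∏ i, if (z i).2 ≤ x₀ then C else 1) ∂Q :=
          integral_mono (integrable_finsetSum _ fun ε _ => hiε ε)
            (((hi1.const_mul 8).add (hi2.const_mul 8)).const_mul _)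
            (sum_exp_signed_sub_le T hT hl)
      _ = _ := by
          rw [integral_const_mul, integral_add (hi1.const_mul 8) (hi2.const_mul 8),
            integral_const_mul, integral_const_mul,
            integral_prod_ite ν (ν.prod ν) Prod.fst x₀ C measurePreserving_fst,
            integral_prod_ite ν (ν.prod ν) Prod.snd x₀ C measurePreserving_snd]
          ring
  refine (le_of_mul_le_mul_left hsum (by positivity)).trans ?_
  rw [mul_assoc (n : ℝ), Real.exp_nat_mul]
  gcongr
  linarith [Real.add_one_le_exp (p * (C - 1))]

end Symmetrization

lemma cosh_sub_one_le_sq {y : ℝ} (hy : |y| ≤ 1) : Real.cosh y - 1 ≤ y ^ 2 := by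
  have hy2 : y ^ 2 ≤ 1 := (sq_le_one_iff_abs_le_one y).2 hy
  have habs : |y ^ 2 / 2| = y ^ 2 / 2 := abs_of_nonneg (by positivity)
  have h := Real.abs_exp_sub_one_le (x := y ^ 2 / 2) (by rw [habs]; linarith)
  rw [habs] at h
  linarith [le_abs_self (Real.exp (y ^ 2 / 2) - 1), Real.cosh_le_exp_half_sq y]

/-- The optimisation over the exponential tilt behind Bernstein-type bounds. -/
lemma exists_bernstein_tilt {t r : ℝ} (ht : 0 ≤ t) (hr : 0 ≤ r) :
    ∃ l, 0 ≤ l ∧ -l * (t * r) + r ^ 2 * (Real.cosh (2 * l) - 1) ≤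
      -(1 / 16) * min (t ^ 2) (t * r) := by
  rcases hr.eq_or_lt with rfl | hr
  · exact ⟨0, le_rfl, by simp [sq_nonneg]⟩
  rcases le_total t (4 * r) with h | h
  · refine ⟨t / (8 * r), by positivity, ?_⟩
    have hc := cosh_sub_one_le_sq (y := 2 * (t / (8 * r))) (by
      rw [abs_of_nonneg (by positivity), ← mul_div_assoc, div_le_one (by positivity)]
      linarith)
    calc _ ≤ -(t / (8 * r)) * (t * r) + r ^ 2 * (2 * (t / (8 * r))) ^ 2 := by gcongr
      _ = -(1 / 16) * t ^ 2 := by field_simp; ring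
      _ ≤ _ := by linarith [min_le_left (t ^ 2) (t * r)]
  · refine ⟨1 / 2, by norm_num, ?_⟩
    have hc := cosh_sub_one_le_sq (y := 2 * (1 / 2)) (by norm_num)
    calc _ ≤ -(1 / 2) * (t * r) + r ^ 2 * (2 * (1 / 2)) ^ 2 := by gcongr
      _ ≤ -(1 / 16) * (t * r) := by nlinarith
      _ ≤ _ := by linarith [min_le_right (t ^ 2) (t * r)]

lemma measure_norm_centred_ge_le {n : ℕ} (ν : Measure ℝ) [IsProbabilityMeasure ν] (T : Finset ℝ)
    {x₀ : ℝ} (hT : ∀ x ∈ T, x ≤ x₀) {t : ℝ} (ht : 0 ≤ t) :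
    (Measure.pi fun _ : Fin n => ν).real
        {ω | t * Real.sqrt (n * cdfOf ν x₀) ≤
          ‖fun x : T => ∑ i, (iicInd x (ω i) - cdfOf ν x)‖} ≤
      16 * Real.exp (-(1 / 16) * min (t ^ 2) (t * Real.sqrt (n * cdfOf ν x₀))) := by
  have hp : 0 ≤ n * cdfOf ν x₀ := mul_nonneg (Nat.cast_nonneg n) ENNReal.toReal_nonneg
  obtain ⟨l, hl, hle⟩ := exists_bernstein_tilt ht (Real.sqrt_nonneg (n * cdfOf ν x₀))
  have hcdf (x : ℝ) : cdfOf ν x ∈ Set.Icc (0 : ℝ) 1 :=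
    ⟨ENNReal.toReal_nonneg, measureReal_le_one⟩
  have hint : Integrable (fun ω => Real.exp
      (l * ‖fun x : T => ∑ i, (iicInd x (ω i) - cdfOf ν x)‖)) (Measure.pi fun _ : Fin n => ν) := by
    refine integrable_exp_mul_of_le (C := n) (measurable_norm_pi fun x => by fun_prop) hl
      fun z => norm_sum_le_card fun x i => ?_
    have h1 := iicInd_mem_Icc x (z i)
    have h2 := hcdf x
    rw [abs_le]
    constructor <;> linarith [h1.1, h1.2, h2.1, h2.2]
  refine (measure_ge_le_exp_mul_mgf _ hl hint).trans ?_
  calc _ ≤ Real.exp (-l * (t * Real.sqrt (n * cdfOf ν x₀))) *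
        (16 * Real.exp (n * cdfOf ν x₀ * (Real.cosh (2 * l) - 1))) := by
        gcongr
        exact integral_exp_norm_le ν T hT hl
    _ = 16 * Real.exp (-l * (t * Real.sqrt (n * cdfOf ν x₀)) +
        n * cdfOf ν x₀ * (Real.cosh (2 * l) - 1)) := by
        rw [Real.exp_add]
        ring
    _ ≤ _ := by
        rw [Real.sq_sqrt hp] at hle
        gcongr

lemma continuousWithinAt_cdfOf (ν : Measure ℝ) [IsProbabilityMeasure ν] (x : ℝ) :
    ContinuousWithinAt (cdfOf ν) (Set.Ici x) x := by
  have h : cdfOf ν = cdf ν := by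
    ext y
    rw [cdf_eq_real]
    rfl
  rw [h]
  exact (cdf ν).right_continuous x

lemma continuousWithinAt_ecdf (n : ℕ) (ω : Fin n → ℝ) (x : ℝ) :
    ContinuousWithinAt (ecdf n ω) (Set.Ici x) x := by
  refine (tendsto_finsetSum _ fun i _ => ?_).div_const _
  refine tendsto_const_nhds.congr' ?_
  by_cases h : ω i ≤ x
  · filter_upwards [self_mem_nhdsWithin] with y hy
    rw [if_pos h, if_pos (h.trans hy)]
  · filter_upwards [mem_nhdsWithin_of_mem_nhds (Iio_mem_nhds (not_le.1 h))] with y hy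
    rw [if_neg h, if_neg (not_le.2 hy)]

/-- A countable set of points of `(-∞, x₀]` detects strict lower bounds for the supremum of a
right-continuous function. -/
lemma exists_seq_detects (x₀ : ℝ) : ∃ d : ℕ → ℝ, (∀ k, d k ≤ x₀) ∧
    ∀ g : ℝ → ℝ, (∀ x, ContinuousWithinAt g (Set.Ici x) x) → ∀ c, ∀ x ≤ x₀, c < g x →
      ∃ k, c < g (d k) := by
  obtain ⟨d, hd⟩ := (((Set.countable_range ((↑) : ℚ → ℝ)).insert x₀).mono
    (Set.inter_subset_left (t := Set.Iic x₀))).exists_eq_range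
    ⟨x₀, Set.mem_insert _ _, Set.self_mem_Iic⟩
  have hmem {y : ℝ} (hy : y ∈ insert x₀ (Set.range ((↑) : ℚ → ℝ))) (hle : y ≤ x₀) :
      ∃ k, d k = y := by
    have : y ∈ Set.range d := hd ▸ ⟨hy, hle⟩
    exact this
  refine ⟨d, fun k => (hd.symm ▸ Set.mem_range_self k : d k ∈ _ ∩ Set.Iic x₀).2, ?_⟩
  intro g hg c x hx hc
  rcases hx.eq_or_lt with rfl | hx
  · obtain ⟨k, hk⟩ := hmem (Set.mem_insert _ _) le_rfl
    exact ⟨k, hk ▸ hc⟩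
  · have hev : ∀ᶠ y in nhdsWithin x (Set.Ioi x), c < g y :=
      ((hg x).mono Set.Ioi_subset_Ici_self).eventually (lt_mem_nhds hc)
    obtain ⟨u, hu, hsub⟩ := mem_nhdsGT_iff_exists_Ioo_subset.1 hev
    obtain ⟨q, hq1, hq2⟩ := exists_rat_btwn (lt_min hu hx)
    obtain ⟨k, hk⟩ := hmem (Set.mem_insert_of_mem _ (Set.mem_range_self q))
      (hq2.le.trans (min_le_right _ _))
    refine ⟨k, hk ▸ hsub ⟨hq1, hq2.trans_le (min_le_left _ _)⟩⟩

lemma mul_abs_ecdf_sub {n : ℕ} (hn : 1 ≤ n) (ω : Fin n → ℝ) (x p : ℝ) :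
    n * |ecdf n ω x - p| = |∑ i, (iicInd x (ω i) - p)| := by
  have hn0 : (0 : ℝ) < n := by exact_mod_cast hn
  nth_rw 1 [← abs_of_pos hn0]
  rw [← abs_mul, ecdf, mul_sub, mul_div_cancel₀ _ hn0.ne', Finset.sum_sub_distrib]
  simp [iicInd]

theorem stmt4 :
    ∃ c₁ c₂ : ℝ, 0 < c₁ ∧ 0 < c₂ ∧
      ∀ (n : ℕ), 1 ≤ n →
      ∀ (ν : Measure ℝ) [IsProbabilityMeasure ν],
      ∀ (x₀ : ℝ) (t : ℝ), 0 ≤ t →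
        (Measure.pi fun _ : Fin n => ν)
            {ω | t * Real.sqrt (cdfOf ν x₀ / n) <
                  ⨆ x : {x : ℝ // x ≤ x₀}, |ecdf n ω x - cdfOf ν x|} ≤
          ENNReal.ofReal (c₁ * Real.exp (-c₂ *
            min (t ^ 2) (t * Real.sqrt (n * cdfOf ν x₀)))) := by
  refine ⟨16, 1 / 16, by norm_num, by norm_num, ?_⟩
  intro n hn ν _ x₀ t ht
  have hn0 : (0 : ℝ) < n := by exact_mod_cast hn
  obtain ⟨d, hd, hdet⟩ := exists_seq_detects x₀
  let A : ℕ → Set (Fin n → ℝ) := fun N =>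
    {ω | ∃ k ≤ N, t * Real.sqrt (cdfOf ν x₀ / n) < |ecdf n ω (d k) - cdfOf ν (d k)|}
  have hA : Monotone A := fun N N' hN ω ⟨k, hk, h⟩ => ⟨k, hk.trans hN, h⟩
  have hsub : {ω : Fin n → ℝ | t * Real.sqrt (cdfOf ν x₀ / n) <
      ⨆ x : {x : ℝ // x ≤ x₀}, |ecdf n ω x - cdfOf ν x|} ⊆ ⋃ N, A N := by
    intro ω hω
    rw [Set.mem_ofPred_eq] at hω
    have : Nonempty {x : ℝ // x ≤ x₀} := ⟨⟨x₀, le_rfl⟩⟩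
    obtain ⟨⟨x, hx⟩, hlt⟩ := exists_lt_of_lt_ciSup hω
    obtain ⟨k, hk⟩ := hdet (fun x => |ecdf n ω x - cdfOf ν x|)
      (fun x => ((continuousWithinAt_ecdf n ω x).sub (continuousWithinAt_cdfOf ν x)).abs) _ x hx hlt
    exact Set.mem_iUnion.2 ⟨k, k, le_rfl, hk⟩
  refine (measure_mono hsub).trans ?_
  rw [hA.measure_iUnion]
  refine iSup_le fun N => ?_
  let T : Finset ℝ := (Finset.range (N + 1)).image d
  have hT : ∀ x ∈ T, x ≤ x₀ := by
    intro x hx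
    obtain ⟨k, -, rfl⟩ := Finset.mem_image.1 hx
    exact hd k
  have hscale : n * (t * Real.sqrt (cdfOf ν x₀ / n)) = t * Real.sqrt (n * cdfOf ν x₀) := by
    have h : (n : ℝ) * cdfOf ν x₀ = n ^ 2 * (cdfOf ν x₀ / n) := by field_simp
    rw [h, Real.sqrt_mul (by positivity), Real.sqrt_sq hn0.le]
    ring
  have hAT : A N ⊆ {ω | t * Real.sqrt (n * cdfOf ν x₀) ≤
      ‖fun x : T => ∑ i, (iicInd x (ω i) - cdfOf ν x)‖} := by
    rintro ω ⟨k, hk, hlt⟩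
    have hkT : d k ∈ T := Finset.mem_image_of_mem d (Finset.mem_range.2 (Nat.lt_succ_of_le hk))
    have h := mul_le_mul_of_nonneg_left hlt.le hn0.le
    rw [hscale, mul_abs_ecdf_sub hn] at h
    exact h.trans
      (norm_le_pi_norm (fun x : T => ∑ i, (iicInd x (ω i) - cdfOf ν x)) ⟨d k, hkT⟩)
  refine (measure_mono hAT).trans ?_
  rw [← ofReal_measureReal]
  exact ENNReal.ofReal_le_ofReal (measure_norm_centred_ge_le ν T hT ht)
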